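/- arXiv:0905.1404 — 6 statements merged into one kernel-verified Lean document; each statement's English description precedes it below -/
import Mathlib

section
/- Let α : I → ℝ³ be a smooth time-like curve parameterized by arc length (⟨α′,α′⟩ ≡ −1) with curvature κ ≡ 1, i.e. N := α′′ satisfies ⟨N,N⟩ ≡ 1, and let B := α′ ×_L N and τ := ⟨N′, B⟩, with τ(s)² > 1 for all s ∈ I. Suppose there are a unit space-like vector d (⟨d,d⟩ = 1) and a constant φ > 0 such that ⟨N(s), d⟩ = cosh(φ) for all s ∈ I. Then there exist a constant c ∈ ℝ and a sign ε ∈ {−1, +1} such that ε·tanh(φ)·τ(s)/√(τ(s)²−1) + s + c = 0 for all s ∈ I; equivalently τ(s) = ε′·(s+c)/√((s+c)² − tanh²(φ)) for some sign ε′. -/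
/- Minkowski 3-space: ℝ³ with the bilinear form ⟨u,v⟩ = -u₁v₁ + u₂v₂ + u₃v₃. -/

noncomputable section

/-- The Minkowski bilinear form on ℝ³. -/
def mink (u v : Fin 3 → ℝ) : ℝ := -(u 0 * v 0) + u 1 * v 1 + u 2 * v 2

/-- The Minkowski norm ‖v‖ = √|⟨v,v⟩|. -/
def mnorm (u : Fin 3 → ℝ) : ℝ := Real.sqrt |mink u u|

/-- The Lorentzian cross product u ×_L v. -/
def lcross (u v : Fin 3 → ℝ) : Fin 3 → ℝ :=
  ![u 1 * v 2 - u 2 * v 1, u 0 * v 2 - u 2 * v 0, u 1 * v 0 - u 0 * v 1]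

/-- n = m / √(m² - 1). -/
def nval (m : ℝ) : ℝ := m / Real.sqrt (m ^ 2 - 1)

/-- For a unit-speed time-like curve with κ ≡ 1: principal normal N = α''. -/
def Narc (α : ℝ → Fin 3 → ℝ) (s : ℝ) : Fin 3 → ℝ := deriv (deriv α) s

/-- Binormal B = α' ×_L α''. -/
def Barc (α : ℝ → Fin 3 → ℝ) (s : ℝ) : Fin 3 → ℝ := lcross (deriv α s) (Narc α s)

/-- Torsion τ = ⟨N', B⟩. -/
def tauArc (α : ℝ → Fin 3 → ℝ) (s : ℝ) : ℝ := mink (deriv (Narc α) s) (Barc α s)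

theorem mink_lcross_mul (T N P Q : Fin 3 → ℝ) :
    mink P (lcross T N) * mink (lcross T N) Q =
      -(mink T T * (mink N N * mink P Q - mink N Q * mink P N)
        - mink T N * (mink N T * mink P Q - mink N Q * mink P T)
        + mink T Q * (mink N T * mink P N - mink N N * mink P T)) := by
  simp [mink, lcross]
  ring

theorem mink_comm' (u v : Fin 3 → ℝ) : mink u v = mink v u := by
  simp only [mink]; ring

theorem hasDerivAt_mink {u v : ℝ → Fin 3 → ℝ} {u' v' : Fin 3 → ℝ} {s : ℝ}
    (hu : HasDerivAt u u' s) (hv : HasDerivAt v v' s) :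
    HasDerivAt (fun t => mink (u t) (v t)) (mink u' (v s) + mink (u s) v') s := by
  have hu := hasDerivAt_pi.1 hu
  have hv := hasDerivAt_pi.1 hv
  have h := (((hu 0).mul (hv 0)).neg.add ((hu 1).mul (hv 1))).add ((hu 2).mul (hv 2))
  refine HasDerivAt.congr_deriv h ?_
  simp only [mink]; ring

theorem deriv_eq_zero_of_const {a b k f' s : ℝ} {f : ℝ → ℝ} (hs : s ∈ Set.Ioo a b)
    (hf : HasDerivAt f f' s) (hk : ∀ t ∈ Set.Ioo a b, f t = k) : f' = 0 := by
  have h : f =ᶠ[nhds s] fun _ => k := by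
    filter_upwards [isOpen_Ioo.mem_nhds hs] with t ht using hk t ht
  exact hf.unique ((hasDerivAt_const s k).congr_of_eventuallyEq h)

/-- for a unit-speed time-like curve with κ ≡ 1 whose normal makes a
constant hyperbolic angle φ with a unit space-like direction d, there exist a constant
c and a sign ε with ε·tanh(φ)·τ(s)/√(τ(s)²-1) + s + c = 0 on I; equivalently
τ(s) = ε'·(s+c)/√((s+c)² - tanh²φ) for some sign ε'. -/
theorem torsion_of_constant_normal_angle (a b : ℝ) (α : ℝ → Fin 3 → ℝ) (φ : ℝ) (d : Fin 3 → ℝ) (hφ : 0 < φ)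
    (hab : a < b)
    (hsmooth : ContDiffOn ℝ (⊤ : ℕ∞) α (Set.Ioo a b))
    (hunit : ∀ s ∈ Set.Ioo a b, mink (deriv α s) (deriv α s) = -1)
    (hcurv : ∀ s ∈ Set.Ioo a b, mink (Narc α s) (Narc α s) = 1)
    (htau : ∀ s ∈ Set.Ioo a b, 1 < (tauArc α s) ^ 2)
    (hd : mink d d = 1)
    (hangle : ∀ s ∈ Set.Ioo a b, mink (Narc α s) d = Real.cosh φ) :
    ∃ c : ℝ, ∃ ε : ℝ, (ε = 1 ∨ ε = -1) ∧
      (∀ s ∈ Set.Ioo a b,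
        ε * Real.tanh φ * tauArc α s / Real.sqrt (tauArc α s ^ 2 - 1) + s + c = 0) ∧
      ∃ ε' : ℝ, (ε' = 1 ∨ ε' = -1) ∧
        ∀ s ∈ Set.Ioo a b,
          tauArc α s = ε' * (s + c) / Real.sqrt ((s + c) ^ 2 - Real.tanh φ ^ 2) := by
  have hO : IsOpen (Set.Ioo a b) := isOpen_Ioo
  have h1 : ContDiffOn ℝ (⊤ : ℕ∞) (deriv α) (Set.Ioo a b) :=
    hsmooth.deriv_of_isOpen hO (by simp)
  have h2 : ContDiffOn ℝ (⊤ : ℕ∞) (Narc α) (Set.Ioo a b) :=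
    h1.deriv_of_isOpen hO (by simp)
  have hT : ∀ s ∈ Set.Ioo a b, HasDerivAt (deriv α) (Narc α s) s := fun s hs =>
    ((h1.differentiableOn (by simp)).differentiableAt (hO.mem_nhds hs)).hasDerivAt
  have hN : ∀ s ∈ Set.Ioo a b, HasDerivAt (Narc α) (deriv (Narc α) s) s := fun s hs =>
    ((h2.differentiableOn (by simp)).differentiableAt (hO.mem_nhds hs)).hasDerivAt
  have hTN : ∀ s ∈ Set.Ioo a b, mink (deriv α s) (Narc α s) = 0 := by
    intro s hs
    have h := deriv_eq_zero_of_const hs (hasDerivAt_mink (hT s hs) (hT s hs)) hunit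
    rw [mink_comm' (Narc α s)] at h
    linarith
  have hPN : ∀ s ∈ Set.Ioo a b, mink (deriv (Narc α) s) (Narc α s) = 0 := by
    intro s hs
    have h := deriv_eq_zero_of_const hs (hasDerivAt_mink (hN s hs) (hN s hs)) hcurv
    rw [mink_comm' (Narc α s)] at h
    linarith
  have hPT : ∀ s ∈ Set.Ioo a b, mink (deriv (Narc α) s) (deriv α s) = -1 := by
    intro s hs
    have h := deriv_eq_zero_of_const hs (hasDerivAt_mink (hT s hs) (hN s hs)) hTN
    rw [hcurv s hs, mink_comm' (deriv α s)] at h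
    linarith
  have hmd : ∀ {u : ℝ → Fin 3 → ℝ} {u' : Fin 3 → ℝ} {s : ℝ}, HasDerivAt u u' s →
      HasDerivAt (fun t => mink (u t) d) (mink u' d) s := by
    intro u u' s hu
    refine (hasDerivAt_mink hu (hasDerivAt_const s d)).congr_deriv ?_
    simp [mink]
  have hPd : ∀ s ∈ Set.Ioo a b, mink (deriv (Narc α) s) d = 0 := fun s hs =>
    deriv_eq_zero_of_const hs (hmd (hN s hs)) hangle
  set x : ℝ → ℝ := fun s => mink (deriv α s) d with hx
  set y : ℝ → ℝ := fun s => mink (Barc α s) d with hy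
  have hxd : ∀ s ∈ Set.Ioo a b, HasDerivAt x (Real.cosh φ) s := fun s hs =>
    (hmd (hT s hs)).congr_deriv (hangle s hs)
  have hxy : ∀ s ∈ Set.Ioo a b, tauArc α s * y s = -x s := by
    intro s hs
    have h := mink_lcross_mul (deriv α s) (Narc α s) (deriv (Narc α) s) d
    rw [hunit s hs, hcurv s hs, hPd s hs, hTN s hs, hPT s hs, hPN s hs] at h
    simp only [hx, hy, tauArc, Barc]
    linarith
  have hyy : ∀ s ∈ Set.Ioo a b, x s ^ 2 - y s ^ 2 = Real.sinh φ ^ 2 := by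
    intro s hs
    have h := mink_lcross_mul (deriv α s) (Narc α s) d d
    rw [mink_comm' d (lcross _ _), mink_comm' d (Narc α s), mink_comm' d (deriv α s),
      mink_comm' (Narc α s) (deriv α s),
      hunit s hs, hcurv s hs, hd, hTN s hs, hangle s hs] at h
    have hc := Real.cosh_sq φ
    simp only [hx, hy, Barc]
    nlinarith
  have hsh : 0 < Real.sinh φ := Real.sinh_pos_iff.2 hφ
  have hch : 0 < Real.cosh φ := Real.cosh_pos φ
  have hth : Real.tanh φ = Real.sinh φ / Real.cosh φ := Real.tanh_eq_sinh_div_cosh φ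
  have hthp : 0 < Real.tanh φ := by rw [hth]; positivity
  have hy2 : ∀ s ∈ Set.Ioo a b, y s ^ 2 * (tauArc α s ^ 2 - 1) = Real.sinh φ ^ 2 := by
    intro s hs
    have e1 := hxy s hs
    have e2 := hyy s hs
    have e3 : x s = -(tauArc α s * y s) := by linarith
    rw [e3] at e2
    linarith
  have hy0 : ∀ s ∈ Set.Ioo a b, y s ≠ 0 := by
    intro s hs h0
    have := hy2 s hs
    rw [h0] at this
    have : 0 < Real.sinh φ ^ 2 := by positivity
    simp_all
  have hyc : ContinuousOn y (Set.Ioo a b) := by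
    have c1 := continuousOn_pi.1 h1.continuousOn
    have c2 := continuousOn_pi.1 h2.continuousOn
    have a0 := c1 0
    have a1 := c1 1
    have a2 := c1 2
    have b0 := c2 0
    have b1 := c2 1
    have b2 := c2 2
    simp only [hy, Barc, mink, lcross, Matrix.cons_val]
    fun_prop
  -- constant sign
  obtain ⟨σ, hσ, hσy⟩ : ∃ σ : ℝ, (σ = 1 ∨ σ = -1) ∧ ∀ s ∈ Set.Ioo a b, 0 < σ * y s := by
    have hpre : IsPreconnected (Set.Ioo a b) := isPreconnected_Ioo
    by_cases hp : ∃ p ∈ Set.Ioo a b, 0 < y p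
    · obtain ⟨p, hp, hyp⟩ := hp
      refine ⟨1, Or.inl rfl, fun s hs => ?_⟩
      by_contra hn
      obtain ⟨z, hz, hz0⟩ := hpre.intermediate_value hs hp hyc
        (show (0 : ℝ) ∈ Set.Icc (y s) (y p) from ⟨by linarith, hyp.le⟩)
      exact hy0 z hz hz0
    · refine ⟨-1, Or.inr rfl, fun s hs => ?_⟩
      push Not at hp
      have := lt_of_le_of_ne (hp s hs) (hy0 s hs)
      linarith
  have hσ2 : σ * σ = 1 := by rcases hσ with h | h <;> rw [h] <;> norm_num
  -- x is affine
  obtain ⟨k, hk⟩ : ∃ k, ∀ s ∈ Set.Ioo a b, x s - Real.cosh φ * s = k := by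
    have hg : ∀ s ∈ Set.Ioo a b, HasDerivAt (fun s => x s - Real.cosh φ * s) 0 s := by
      intro s hs
      refine ((hxd s hs).sub ((hasDerivAt_id s).const_mul (Real.cosh φ))).congr_deriv ?_
      simp
    exact hO.exists_is_const_of_deriv_eq_zero isPreconnected_Ioo
      (fun s hs => (hg s hs).differentiableAt.differentiableWithinAt)
      (fun s hs => (hg s hs).deriv)
  have key : ∀ s ∈ Set.Ioo a b, σ * Real.tanh φ * tauArc α s /
      Real.sqrt (tauArc α s ^ 2 - 1) + s + k / Real.cosh φ = 0 := by
    intro s hs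
    have hr : 0 < tauArc α s ^ 2 - 1 := by linarith [htau s hs]
    have hq := Real.sqrt_pos.2 hr
    have hqq := Real.sq_sqrt hr.le
    have e1 : σ * y s * Real.sqrt (tauArc α s ^ 2 - 1) = Real.sinh φ := by
      refine (sq_eq_sq₀ (mul_pos (hσy s hs) hq).le hsh.le).1 ?_
      rw [mul_pow, hqq, mul_pow, ← hy2 s hs, pow_two σ, hσ2]; ring
    have e2 := hxy s hs
    have e3 := hk s hs
    have e4 : σ * Real.sinh φ = y s * Real.sqrt (tauArc α s ^ 2 - 1) := by
      rw [← e1]; linear_combination (y s * Real.sqrt (tauArc α s ^ 2 - 1)) * hσ2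
    rw [hth, ← e3]
    field_simp
    linear_combination (tauArc α s) * e4 + Real.sqrt (tauArc α s ^ 2 - 1) * e2
  refine ⟨k / Real.cosh φ, σ, hσ, key, -σ, ?_, ?_⟩
  · rcases hσ with h | h <;> simp [h]
  · intro s hs
    have hr : 0 < tauArc α s ^ 2 - 1 := by linarith [htau s hs]
    have hq := Real.sqrt_pos.2 hr
    have hqq := Real.sq_sqrt hr.le
    have e : s + k / Real.cosh φ = -(σ * Real.tanh φ * tauArc α s /
      Real.sqrt (tauArc α s ^ 2 - 1)) := by linarith [key s hs]
    have e5 : (s + k / Real.cosh φ) ^ 2 - Real.tanh φ ^ 2 =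
        (Real.tanh φ / Real.sqrt (tauArc α s ^ 2 - 1)) ^ 2 := by
      rw [e, neg_sq, div_pow, div_pow, hqq]
      field_simp
      linear_combination (tauArc α s ^ 2) * hσ2
    rw [e5, Real.sqrt_sq (by positivity), e]
    field_simp
    linear_combination (-tauArc α s) * hσ2
end
end

section
/- Let α : I → ℝ³ be a smooth time-like curve parameterized by arc length with curvature κ ≡ 1 (N := α′′, ⟨N,N⟩ ≡ 1), B := α′ ×_L N, τ := ⟨N′,B⟩ smooth with τ(s)² > 1 on I, and suppose the unit space-like vector d satisfies ⟨N(s), d⟩ = cosh(φ) for all s, with φ > 0. Then the torsion satisfies the differential equation ε·tanh(φ)·τ′(s)/(τ(s)²−1)^{3/2} + 1 = 0 on I, for some sign ε ∈ {−1, +1}. -/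
/- Minkowski 3-space: ℝ³ with the bilinear form ⟨u,v⟩ = -u₁v₁ + u₂v₂ + u₃v₃. -/

noncomputable section

theorem mink_hasDerivAt {f g : ℝ → Fin 3 → ℝ} {f' g' : Fin 3 → ℝ} {s : ℝ}
    (hf : HasDerivAt f f' s) (hg : HasDerivAt g g' s) :
    HasDerivAt (fun t => mink (f t) (g t)) (mink f' (g s) + mink (f s) g') s := by
  have hf := hasDerivAt_pi.1 hf
  have hg := hasDerivAt_pi.1 hg
  have h := ((((hf 0).mul (hg 0)).neg).add ((hf 1).mul (hg 1))).add ((hf 2).mul (hg 2))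
  refine h.congr_deriv ?_
  simp only [mink]; ring

theorem lcross_hasDerivAt {f g : ℝ → Fin 3 → ℝ} {f' g' : Fin 3 → ℝ} {s : ℝ}
    (hf : HasDerivAt f f' s) (hg : HasDerivAt g g' s) :
    HasDerivAt (fun t => lcross (f t) (g t)) (lcross f' (g s) + lcross (f s) g') s := by
  have hf := hasDerivAt_pi.1 hf
  have hg := hasDerivAt_pi.1 hg
  refine hasDerivAt_pi.2 fun i => ?_
  fin_cases i
  · refine (((hf 1).mul (hg 2)).sub ((hf 2).mul (hg 1))).congr_deriv ?_
    simp [lcross]; ring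
  · refine (((hf 0).mul (hg 2)).sub ((hf 2).mul (hg 0))).congr_deriv ?_
    simp [lcross]; ring
  · refine (((hf 1).mul (hg 0)).sub ((hf 0).mul (hg 1))).congr_deriv ?_
    simp [lcross]; ring

theorem mink_gram (T N u v : Fin 3 → ℝ) (hT : mink T T = -1) (hN : mink N N = 1)
    (hTN : mink T N = 0) :
    mink u v = -(mink u T * mink T v) + mink u N * mink N v
      + mink u (lcross T N) * mink (lcross T N) v := by
  have key : mink u (lcross T N) * mink (lcross T N) v =
      -(mink T T * (mink N N * mink u v - mink N v * mink u N)
        - mink T N * (mink T N * mink u v - mink N v * mink u T)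
        + mink T v * (mink T N * mink u N - mink N N * mink u T)) := by
    simp [mink, lcross]; ring
  rw [key, hT, hN, hTN]; ring

theorem const_deriv {a b s c c' : ℝ} {f : ℝ → ℝ} (hs : s ∈ Set.Ioo a b)
    (hf : ∀ t ∈ Set.Ioo a b, f t = c) (h : HasDerivAt f c' s) : c' = 0 := by
  have h2 : HasDerivAt f 0 s := (hasDerivAt_const s c).congr_of_eventuallyEq
    (Filter.eventuallyEq_of_mem (isOpen_Ioo.mem_nhds hs) hf)
  exact h.unique h2

/-- under the hypotheses of Lemma 1, the torsion satisfies the ODE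
ε·tanh(φ)·τ'(s)/(τ(s)²-1)^{3/2} + 1 = 0 on I, for some sign ε. -/
theorem torsion_ode_of_constant_normal_angle (a b : ℝ) (α : ℝ → Fin 3 → ℝ) (φ : ℝ) (d : Fin 3 → ℝ) (hφ : 0 < φ)
    (hab : a < b)
    (hsmooth : ContDiffOn ℝ (⊤ : ℕ∞) α (Set.Ioo a b))
    (hunit : ∀ s ∈ Set.Ioo a b, mink (deriv α s) (deriv α s) = -1)
    (hcurv : ∀ s ∈ Set.Ioo a b, mink (Narc α s) (Narc α s) = 1)
    (htau : ∀ s ∈ Set.Ioo a b, 1 < (tauArc α s) ^ 2)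
    (hd : mink d d = 1)
    (hangle : ∀ s ∈ Set.Ioo a b, mink (Narc α s) d = Real.cosh φ)
    (htausmooth : ContDiffOn ℝ (⊤ : ℕ∞) (tauArc α) (Set.Ioo a b)) :
    ∃ ε : ℝ, (ε = 1 ∨ ε = -1) ∧
      ∀ s ∈ Set.Ioo a b,
        ε * Real.tanh φ * deriv (tauArc α) s / (tauArc α s ^ 2 - 1) ^ ((3 : ℝ) / 2)
          + 1 = 0 := by
  have hT1 : ContDiffOn ℝ (⊤ : ℕ∞) (deriv α) (Set.Ioo a b) :=
    hsmooth.deriv_of_isOpen isOpen_Ioo (by simp)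
  have hN1 : ContDiffOn ℝ (⊤ : ℕ∞) (Narc α) (Set.Ioo a b) :=
    hT1.deriv_of_isOpen isOpen_Ioo (by simp)
  have dT : ∀ s ∈ Set.Ioo a b, HasDerivAt (deriv α) (Narc α s) s := fun s hs =>
    ((hT1.contDiffAt (isOpen_Ioo.mem_nhds hs)).differentiableAt (by simp)).hasDerivAt
  have dN : ∀ s ∈ Set.Ioo a b, HasDerivAt (Narc α) (deriv (Narc α) s) s := fun s hs =>
    ((hN1.contDiffAt (isOpen_Ioo.mem_nhds hs)).differentiableAt (by simp)).hasDerivAt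
  have dtau : ∀ s ∈ Set.Ioo a b, HasDerivAt (tauArc α) (deriv (tauArc α) s) s := fun s hs =>
    ((htausmooth.contDiffAt (isOpen_Ioo.mem_nhds hs)).differentiableAt (by simp)).hasDerivAt
  have comm : ∀ u v, mink u v = mink v u := fun u v => by simp only [mink]; ring
  have hTN : ∀ s ∈ Set.Ioo a b, mink (deriv α s) (Narc α s) = 0 := by
    intro s hs
    have h := const_deriv hs hunit (mink_hasDerivAt (dT s hs) (dT s hs))
    rw [comm (Narc α s)] at h; linarith
  have hNP : ∀ s ∈ Set.Ioo a b, mink (Narc α s) (deriv (Narc α) s) = 0 := by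
    intro s hs
    have h := const_deriv hs hcurv (mink_hasDerivAt (dN s hs) (dN s hs))
    rw [comm (deriv (Narc α) s)] at h; linarith
  have hTP : ∀ s ∈ Set.Ioo a b, mink (deriv α s) (deriv (Narc α) s) = -1 := by
    intro s hs
    have h := const_deriv hs hTN (mink_hasDerivAt (dT s hs) (dN s hs))
    rw [hcurv s hs] at h; linarith
  have m0 : ∀ u, mink u 0 = 0 := fun u => by simp [mink]
  have hPd : ∀ s ∈ Set.Ioo a b, mink (deriv (Narc α) s) d = 0 := by
    intro s hs
    have h := const_deriv hs hangle (mink_hasDerivAt (dN s hs) (hasDerivAt_const s d))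
    rw [m0] at h; linarith
  have dx : ∀ s ∈ Set.Ioo a b,
      HasDerivAt (fun t => mink (deriv α t) d) (Real.cosh φ) s := by
    intro s hs
    refine (mink_hasDerivAt (dT s hs) (hasDerivAt_const s d)).congr_deriv ?_
    rw [m0, hangle s hs, add_zero]
  have hB : ∀ s, Barc α s = lcross (deriv α s) (Narc α s) := fun s => rfl
  have hxz : ∀ s ∈ Set.Ioo a b,
      mink (deriv α s) d + tauArc α s * mink (Barc α s) d = 0 := by
    intro s hs
    have h := mink_gram _ _ (deriv (Narc α) s) d (hunit s hs) (hcurv s hs) (hTN s hs)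
    rw [hPd s hs, comm _ (deriv α s), hTP s hs, comm _ (Narc α s), hNP s hs, ← hB] at h
    simp only [tauArc]; linarith
  have hsum : ∀ s ∈ Set.Ioo a b,
      mink (Barc α s) d ^ 2 * (tauArc α s ^ 2 - 1) = Real.sinh φ ^ 2 := by
    intro s hs
    have h := mink_gram _ _ d d (hunit s hs) (hcurv s hs) (hTN s hs)
    rw [hd, comm d (deriv α s), comm d (Narc α s), hangle s hs, ← hB, comm d (Barc α s)] at h
    have hx : mink (deriv α s) d = - (tauArc α s * mink (Barc α s) d) := by
      linarith [hxz s hs]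
    rw [hx] at h
    have := Real.cosh_sq φ
    linear_combination h + this
  have dz : ∀ s ∈ Set.Ioo a b,
      HasDerivAt (fun t => mink (Barc α t) d) (-(tauArc α s * Real.cosh φ)) s := by
    intro s hs
    refine (mink_hasDerivAt (lcross_hasDerivAt (dT s hs) (dN s hs))
      (hasDerivAt_const s d)).congr_deriv ?_
    have e1 : lcross (Narc α s) (Narc α s) = 0 := by
      ext i; fin_cases i <;> simp [lcross] <;> ring
    rw [m0, e1, zero_add, add_zero,
      mink_gram _ _ _ d (hunit s hs) (hcurv s hs) (hTN s hs), hangle s hs]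
    have f1 : ∀ T P : Fin 3 → ℝ, mink (lcross T P) T = 0 := by
      intro T P; simp [mink, lcross]; ring
    have f2 : ∀ T N P : Fin 3 → ℝ, mink (lcross T P) N = - mink P (lcross T N) := by
      intro T N P; simp [mink, lcross]; ring
    have f3 : ∀ T N P : Fin 3 → ℝ, mink (lcross T P) (lcross T N) =
        mink T P * mink T N - mink T T * mink N P := by
      intro T N P; simp [mink, lcross]; ring
    rw [f1, f2, f3, hTN s hs, hNP s hs]
    simp only [tauArc, Barc]; ring
  have hode : ∀ s ∈ Set.Ioo a b,
      deriv (tauArc α) s * mink (Barc α s) d = Real.cosh φ * (tauArc α s ^ 2 - 1) := by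
    intro s hs
    have h := const_deriv hs hxz ((dx s hs).add ((dtau s hs).mul (dz s hs)))
    linear_combination h
  have hsinh : 0 < Real.sinh φ := Real.sinh_pos_iff.2 hφ
  have hcosh : 0 < Real.cosh φ := Real.cosh_pos φ
  have hz0 : ∀ s ∈ Set.Ioo a b, mink (Barc α s) d ≠ 0 := by
    intro s hs h0
    have h := hsum s hs
    rw [h0] at h
    have : 0 < Real.sinh φ ^ 2 := by positivity
    norm_num at h; exact this.ne h
  have hcont : ContinuousOn (fun t => mink (Barc α t) d) (Set.Ioo a b) := fun s hs =>
    (dz s hs).continuousAt.continuousWithinAt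
  have hsign : ∃ ε : ℝ, (ε = 1 ∨ ε = -1) ∧ ∀ s ∈ Set.Ioo a b, ε * mink (Barc α s) d < 0 := by
    by_cases hp : ∃ s ∈ Set.Ioo a b, 0 < mink (Barc α s) d
    · obtain ⟨s, hs, hps⟩ := hp
      refine ⟨-1, Or.inr rfl, fun t ht => ?_⟩
      by_contra hneg
      have hle : mink (Barc α t) d ≤ 0 := by linarith
      obtain ⟨r, hr, hr0⟩ := isPreconnected_Ioo.intermediate_value ht hs hcont ⟨hle, hps.le⟩
      exact hz0 r hr hr0
    · refine ⟨1, Or.inl rfl, fun t ht => ?_⟩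
      have h1 : ¬ 0 < mink (Barc α t) d := fun h => hp ⟨t, ht, h⟩
      have := lt_of_le_of_ne (not_lt.1 h1) (hz0 t ht)
      linarith
  obtain ⟨ε, hε, hεz⟩ := hsign
  refine ⟨ε, hε, fun s hs => ?_⟩
  have hw : 0 < tauArc α s ^ 2 - 1 := by linarith [htau s hs]
  have hε2 : ε ^ 2 = 1 := by rcases hε with h | h <;> rw [h] <;> norm_num
  have hneg := hεz s hs
  have h1 := hsum s hs
  have h2 := hode s hs
  have hpow : (tauArc α s ^ 2 - 1) ^ ((3 : ℝ) / 2)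
      = (tauArc α s ^ 2 - 1) * Real.sqrt (tauArc α s ^ 2 - 1) := by
    rw [Real.sqrt_eq_rpow, show (3 : ℝ) / 2 = 1 + 1 / 2 by norm_num, Real.rpow_add hw,
      Real.rpow_one]
  rw [hpow, Real.tanh_eq_sinh_div_cosh]
  set w := tauArc α s ^ 2 - 1 with hwdef
  set z := mink (Barc α s) d
  have hq : 0 < Real.sqrt w := Real.sqrt_pos.2 hw
  have hqq : Real.sqrt w ^ 2 = w := Real.sq_sqrt hw.le
  set q := Real.sqrt w
  have hzq : -(ε * z) * q = Real.sinh φ := by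
    have hpos : 0 < -(ε * z) * q := mul_pos (by linarith) hq
    have hsq : (-(ε * z) * q) ^ 2 = Real.sinh φ ^ 2 := by
      rw [← h1, ← hqq]; linear_combination z ^ 2 * q ^ 2 * hε2
    exact (pow_left_inj₀ hpos.le hsinh.le two_ne_zero).1 hsq
  rw [← hzq]
  field_simp
  linear_combination (-ε ^ 2) * h2 - Real.cosh φ * w * hε2
end
end

section
/- Let α : I → ℝ³ be a smooth time-like curve parameterized by arc length with Frenet frame T_α = α′, N_α = α′′/κ_α where κ_α = ‖α′′‖ > 0, B_α = T_α ×_L N_α, and torsion τ_α = ⟨N_α′, B_α⟩, and assume τ_α > 0 on I. Fix t₀ ∈ I and define β(t) = ∫_{t₀}^{t} T_α(u)·‖B_α′(u)‖ du. Then β is a regular time-like curve with ‖β′‖ = τ_α, its Frenet apparatus (defined with speed v = ‖β′‖, T_β = β′/v, κ_β = ‖T_β′‖/v, N_β = T_β′/‖T_β′‖, B_β = T_β ×_L N_β, τ_β = ⟨N_β′, B_β⟩/v) satisfies κ_β = κ_α/τ_α, τ_β = 1, T_β = T_α, N_β = N_α, and B_β = B_α. -/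
/- Minkowski 3-space: ℝ³ with the bilinear form ⟨u,v⟩ = -u₁v₁ + u₂v₂ + u₃v₃. -/

noncomputable section

/-- Unit tangent T = c' / ‖c'‖ of a regular curve. -/
def Tof (c : ℝ → Fin 3 → ℝ) (t : ℝ) : Fin 3 → ℝ := (mnorm (deriv c t))⁻¹ • deriv c t

/-- Principal normal N = T' / ‖T'‖. -/
def Nof (c : ℝ → Fin 3 → ℝ) (t : ℝ) : Fin 3 → ℝ :=
  (mnorm (deriv (Tof c) t))⁻¹ • deriv (Tof c) t

/-- Binormal B = T ×_L N. -/
def Bof (c : ℝ → Fin 3 → ℝ) (t : ℝ) : Fin 3 → ℝ := lcross (Tof c t) (Nof c t)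

/-- Curvature κ = ‖T'‖ / ‖c'‖. -/
def curvOf (c : ℝ → Fin 3 → ℝ) (t : ℝ) : ℝ := mnorm (deriv (Tof c) t) / mnorm (deriv c t)

/-- Torsion τ = ⟨N', B⟩ / ‖c'‖. -/
def torsOf (c : ℝ → Fin 3 → ℝ) (t : ℝ) : ℝ :=
  mink (deriv (Nof c) t) (Bof c t) / mnorm (deriv c t)

/-- For a unit-speed curve: curvature κ_α = ‖α''‖. -/
def kArc (α : ℝ → Fin 3 → ℝ) (t : ℝ) : ℝ := mnorm (deriv (deriv α) t)

/-- Principal normal N_α = α'' / κ_α. -/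
def NArc (α : ℝ → Fin 3 → ℝ) (t : ℝ) : Fin 3 → ℝ := (kArc α t)⁻¹ • deriv (deriv α) t

/-- Binormal B_α = α' ×_L N_α. -/
def BArc (α : ℝ → Fin 3 → ℝ) (t : ℝ) : Fin 3 → ℝ := lcross (deriv α t) (NArc α t)

/-- Torsion τ_α = ⟨N_α', B_α⟩. -/
def tArc (α : ℝ → Fin 3 → ℝ) (t : ℝ) : ℝ := mink (deriv (NArc α) t) (BArc α t)

lemma aux_mink_hasDerivAt {f g : ℝ → Fin 3 → ℝ} {f' g' : Fin 3 → ℝ} {t : ℝ}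
    (hf : HasDerivAt f f' t) (hg : HasDerivAt g g' t) :
    HasDerivAt (fun s => mink (f s) (g s)) (mink f' (g t) + mink (f t) g') t := by
  rw [hasDerivAt_pi] at hf hg
  unfold mink
  refine HasDerivAt.congr_deriv
    (((((hf 0).mul (hg 0)).neg).add ((hf 1).mul (hg 1))).add ((hf 2).mul (hg 2))) ?_
  ring

lemma aux_lcross_hasDerivAt {f g : ℝ → Fin 3 → ℝ} {f' g' : Fin 3 → ℝ} {t : ℝ}
    (hf : HasDerivAt f f' t) (hg : HasDerivAt g g' t) :
    HasDerivAt (fun s => lcross (f s) (g s)) (lcross f' (g t) + lcross (f t) g') t := by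
  rw [hasDerivAt_pi] at hf hg ⊢
  intro i
  fin_cases i
  · refine HasDerivAt.congr_deriv (((hf 1).mul (hg 2)).sub ((hf 2).mul (hg 1))) ?_
    simp [lcross]; ring
  · refine HasDerivAt.congr_deriv (((hf 0).mul (hg 2)).sub ((hf 2).mul (hg 0))) ?_
    simp [lcross]; ring
  · refine HasDerivAt.congr_deriv (((hf 1).mul (hg 0)).sub ((hf 0).mul (hg 1))) ?_
    simp [lcross]; ring

lemma aux_mink_contDiffOn {f g : ℝ → Fin 3 → ℝ} {s : Set ℝ}
    (hf : ContDiffOn ℝ (⊤ : ℕ∞) f s) (hg : ContDiffOn ℝ (⊤ : ℕ∞) g s) :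
    ContDiffOn ℝ (⊤ : ℕ∞) (fun x => mink (f x) (g x)) s := by
  rw [contDiffOn_pi] at hf hg
  unfold mink
  exact ((((hf 0).mul (hg 0)).neg).add ((hf 1).mul (hg 1))).add ((hf 2).mul (hg 2))

lemma aux_lcross_contDiffOn {f g : ℝ → Fin 3 → ℝ} {s : Set ℝ}
    (hf : ContDiffOn ℝ (⊤ : ℕ∞) f s) (hg : ContDiffOn ℝ (⊤ : ℕ∞) g s) :
    ContDiffOn ℝ (⊤ : ℕ∞) (fun x => lcross (f x) (g x)) s := by
  rw [contDiffOn_pi] at hf hg ⊢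
  intro i
  fin_cases i
  · exact ((hf 1).mul (hg 2)).sub ((hf 2).mul (hg 1))
  · exact ((hf 0).mul (hg 2)).sub ((hf 2).mul (hg 0))
  · exact ((hf 1).mul (hg 0)).sub ((hf 0).mul (hg 1))

lemma aux_spacelike {T A : Fin 3 → ℝ} (hT : mink T T = -1) (hTA : mink T A = 0) :
    0 ≤ mink A A := by
  unfold mink at *
  have h0 : T 0 ^ 2 = 1 + T 1 ^ 2 + T 2 ^ 2 := by linarith
  have h1 : T 0 * A 0 = T 1 * A 1 + T 2 * A 2 := by linarith
  have h2 : T 0 ^ 2 * (-(A 0 * A 0) + A 1 * A 1 + A 2 * A 2)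
      = A 1 ^ 2 + A 2 ^ 2 + (T 1 * A 2 - T 2 * A 1) ^ 2 := by
    have : T 0 ^ 2 * (-(A 0 * A 0) + A 1 * A 1 + A 2 * A 2)
      = - (T 0 * A 0) ^ 2 + T 0 ^ 2 * (A 1 ^ 2 + A 2 ^ 2) := by ring
    rw [this, h1, h0]; ring
  have h3 : 0 < T 0 ^ 2 := by rw [h0]; positivity
  by_contra h
  push Not at h
  have := mul_neg_of_pos_of_neg h3 h
  rw [h2] at this
  have : 0 ≤ A 1 ^ 2 + A 2 ^ 2 + (T 1 * A 2 - T 2 * A 1) ^ 2 := by positivity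
  linarith

lemma aux_lagrange (u v : Fin 3 → ℝ) :
    mink (lcross u v) (lcross u v) = mink u v ^ 2 - mink u u * mink v v := by
  simp [mink, lcross]; ring

lemma aux_gram (T N W : Fin 3 → ℝ) :
    mink W (lcross T N) ^ 2 = - (mink T T * (mink N N * mink W W - mink N W ^ 2)
      - mink T N * (mink T N * mink W W - mink N W * mink T W)
      + mink T W * (mink T N * mink N W - mink N N * mink T W)) := by
  simp [mink, lcross]; ring

lemma aux_mink_smul (c d : ℝ) (u v : Fin 3 → ℝ) :
    mink (c • u) (d • v) = c * d * mink u v := by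
  simp [mink]; ring

lemma aux_mnorm_smul (c : ℝ) (hc : 0 < c) (u : Fin 3 → ℝ) :
    mnorm (c • u) = c * mnorm u := by
  unfold mnorm
  rw [aux_mink_smul, abs_mul, Real.sqrt_mul (abs_nonneg _), abs_of_pos (mul_pos hc hc),
    Real.sqrt_mul_self hc.le]

theorem constant_torsion_from_constant_curvature (a b t₀ : ℝ) (α : ℝ → Fin 3 → ℝ)
    (hab : a < b) (ht₀ : t₀ ∈ Set.Ioo a b)
    (hsmooth : ContDiffOn ℝ (⊤ : ℕ∞) α (Set.Ioo a b))
    (hunit : ∀ t ∈ Set.Ioo a b, mink (deriv α t) (deriv α t) = -1)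
    (hk : ∀ t ∈ Set.Ioo a b, 0 < kArc α t)
    (ht : ∀ t ∈ Set.Ioo a b, 0 < tArc α t) :
    ∀ t ∈ Set.Ioo a b,
      mink (deriv (fun s : ℝ => ∫ u in t₀..s, mnorm (deriv (BArc α) u) • deriv α u) t)
        (deriv (fun s : ℝ => ∫ u in t₀..s, mnorm (deriv (BArc α) u) • deriv α u) t) < 0 ∧
      mnorm (deriv (fun s : ℝ => ∫ u in t₀..s, mnorm (deriv (BArc α) u) • deriv α u) t)
        = tArc α t ∧
      curvOf (fun s : ℝ => ∫ u in t₀..s, mnorm (deriv (BArc α) u) • deriv α u) t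
        = kArc α t / tArc α t ∧
      torsOf (fun s : ℝ => ∫ u in t₀..s, mnorm (deriv (BArc α) u) • deriv α u) t = 1 ∧
      Tof (fun s : ℝ => ∫ u in t₀..s, mnorm (deriv (BArc α) u) • deriv α u) t
        = deriv α t ∧
      Nof (fun s : ℝ => ∫ u in t₀..s, mnorm (deriv (BArc α) u) • deriv α u) t
        = NArc α t ∧
      Bof (fun s : ℝ => ∫ u in t₀..s, mnorm (deriv (BArc α) u) • deriv α u) t
        = BArc α t := by
  have hopen : IsOpen (Set.Ioo a b) := isOpen_Ioo
  have hderiv : ∀ f : ℝ → Fin 3 → ℝ, ContDiffOn ℝ (⊤ : ℕ∞) f (Set.Ioo a b) →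
      ContDiffOn ℝ (⊤ : ℕ∞) (deriv f) (Set.Ioo a b) := fun f hf =>
    hf.deriv_of_isOpen hopen (by norm_cast)
  have hHas : ∀ f : ℝ → Fin 3 → ℝ, ContDiffOn ℝ (⊤ : ℕ∞) f (Set.Ioo a b) →
      ∀ t ∈ Set.Ioo a b, HasDerivAt f (deriv f t) t := fun f hf t h =>
    ((hf.contDiffAt (hopen.mem_nhds h)).differentiableAt (by simp)).hasDerivAt
  have hT := hderiv _ hsmooth
  have hA := hderiv _ hT
  -- ⟨T, A⟩ = 0
  have hconst : ∀ (f : ℝ → ℝ) (c d t : ℝ), t ∈ Set.Ioo a b → HasDerivAt f d t →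
      (∀ s ∈ Set.Ioo a b, f s = c) → d = 0 := by
    intro f c d t h hd hc
    have : f =ᶠ[nhds t] fun _ => c := Filter.eventuallyEq_of_mem (hopen.mem_nhds h) hc
    exact hd.unique ((hasDerivAt_const t c).congr_of_eventuallyEq this)
  have hcomm : ∀ u v, mink u v = mink v u := fun u v => by unfold mink; ring
  have hTA : ∀ t ∈ Set.Ioo a b, mink (deriv α t) (deriv (deriv α) t) = 0 := by
    intro t h
    have h1 := hconst _ _ _ t h (aux_mink_hasDerivAt (hHas _ hT t h) (hHas _ hT t h)) hunit
    rw [hcomm (deriv (deriv α) t)] at h1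
    linarith
  have hAA : ∀ t ∈ Set.Ioo a b,
      0 < mink (deriv (deriv α) t) (deriv (deriv α) t) := by
    intro t h
    refine lt_of_le_of_ne (aux_spacelike (hunit t h) (hTA t h)) fun h0 => ?_
    have := hk t h
    simp [kArc, mnorm, ← h0] at this
  have hkeq : ∀ t ∈ Set.Ioo a b, kArc α t =
      Real.sqrt (mink (deriv (deriv α) t) (deriv (deriv α) t)) := fun t h => by
    rw [kArc, mnorm, abs_of_pos (hAA t h)]
  have hkC : ContDiffOn ℝ (⊤ : ℕ∞) (kArc α) (Set.Ioo a b) :=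
    ((aux_mink_contDiffOn hA hA).sqrt (fun t h => (hAA t h).ne')).congr hkeq
  have hN : ContDiffOn ℝ (⊤ : ℕ∞) (NArc α) (Set.Ioo a b) :=
    (hkC.inv (fun t h => (hk t h).ne')).smul hA
  have hB : ContDiffOn ℝ (⊤ : ℕ∞) (BArc α) (Set.Ioo a b) := aux_lcross_contDiffOn hT hN
  have hB' := hderiv _ hB
  have hNN : ∀ t ∈ Set.Ioo a b, mink (NArc α t) (NArc α t) = 1 := by
    intro t h
    have h1 := hk t h
    have h2 : kArc α t ^ 2 = mink (deriv (deriv α) t) (deriv (deriv α) t) := by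
      rw [hkeq t h, Real.sq_sqrt (hAA t h).le]
    rw [NArc, aux_mink_smul, ← h2]
    field_simp
  have hTN : ∀ t ∈ Set.Ioo a b, mink (deriv α t) (NArc α t) = 0 := by
    intro t h
    have := aux_mink_smul 1 (kArc α t)⁻¹ (deriv α t) (deriv (deriv α) t)
    rw [one_smul, hTA t h, mul_zero] at this
    exact this
  have hNN' : ∀ t ∈ Set.Ioo a b, mink (NArc α t) (deriv (NArc α) t) = 0 := by
    intro t h
    have h1 := hconst _ _ _ t h (aux_mink_hasDerivAt (hHas _ hN t h) (hHas _ hN t h)) hNN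
    rw [hcomm (deriv (NArc α) t)] at h1
    linarith
  have hBd : ∀ t ∈ Set.Ioo a b, deriv (BArc α) t = lcross (deriv α t) (deriv (NArc α) t) := by
    intro t h
    have h1 := (aux_lcross_hasDerivAt (hHas _ hT t h) (hHas _ hN t h)).deriv
    have h2 : lcross (deriv (deriv α) t) (NArc α t) = 0 := by
      ext i; fin_cases i <;> simp [lcross, NArc] <;> ring
    rw [h2, zero_add] at h1
    exact h1
  have hBn : ∀ t ∈ Set.Ioo a b, mnorm (deriv (BArc α) t) = tArc α t := by
    intro t h
    have h1 := aux_gram (deriv α t) (NArc α t) (deriv (NArc α) t)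
    have h2 := aux_lagrange (deriv α t) (deriv (NArc α) t)
    rw [hunit t h] at h1 h2
    rw [hTN t h, hNN t h, hNN' t h] at h1
    have h3 : mink (deriv (BArc α) t) (deriv (BArc α) t) = tArc α t ^ 2 := by
      rw [hBd t h, h2, tArc, BArc, h1]; ring
    rw [mnorm, h3, abs_of_nonneg (sq_nonneg _), Real.sqrt_sq (ht t h).le]
  have hcont : ContinuousOn (fun u => mnorm (deriv (BArc α) u) • deriv α u) (Set.Ioo a b) := by
    have h1 : ContinuousOn (fun u => mnorm (deriv (BArc α) u)) (Set.Ioo a b) :=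
      ((aux_mink_contDiffOn hB' hB').continuousOn.abs).sqrt
    exact h1.smul hT.continuousOn
  set β : ℝ → Fin 3 → ℝ := fun s : ℝ => ∫ u in t₀..s, mnorm (deriv (BArc α) u) • deriv α u
    with hβ
  have hβd : ∀ t ∈ Set.Ioo a b, deriv β t = tArc α t • deriv α t := by
    intro t h
    rw [← hBn t h]
    have hsub : Set.uIcc t₀ t ⊆ Set.Ioo a b := Set.OrdConnected.uIcc_subset Set.ordConnected_Ioo ht₀ h
    exact (intervalIntegral.integral_hasDerivAt_right
      (hcont.mono hsub).intervalIntegrable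
      (hcont.stronglyMeasurableAtFilter hopen t h)
      (hcont.continuousAt (hopen.mem_nhds h))).deriv
  have hTn : ∀ t ∈ Set.Ioo a b, mnorm (deriv α t) = 1 := fun t h => by
    rw [mnorm, hunit t h]; simp
  have hβn : ∀ t ∈ Set.Ioo a b, mnorm (deriv β t) = tArc α t := fun t h => by
    rw [hβd t h, aux_mnorm_smul _ (ht t h), hTn t h, mul_one]
  have hβT : ∀ t ∈ Set.Ioo a b, Tof β t = deriv α t := fun t h => by
    rw [Tof, hβn t h, hβd t h, inv_smul_smul₀ (ht t h).ne']
  have hβT' : ∀ t ∈ Set.Ioo a b, deriv (Tof β) t = deriv (deriv α) t := fun t h =>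
    Filter.EventuallyEq.deriv_eq (Filter.eventuallyEq_of_mem (hopen.mem_nhds h) hβT)
  have hβN : ∀ t ∈ Set.Ioo a b, Nof β t = NArc α t := fun t h => by
    rw [Nof, hβT' t h]; rfl
  have hβN' : ∀ t ∈ Set.Ioo a b, deriv (Nof β) t = deriv (NArc α) t := fun t h =>
    Filter.EventuallyEq.deriv_eq (Filter.eventuallyEq_of_mem (hopen.mem_nhds h) hβN)
  have hβB : ∀ t ∈ Set.Ioo a b, Bof β t = BArc α t := fun t h => by
    rw [Bof, hβT t h, hβN t h]; rfl
  intro t h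
  refine ⟨?_, hβn t h, ?_, ?_, hβT t h, hβN t h, hβB t h⟩
  · rw [hβd t h, aux_mink_smul, hunit t h]
    have := mul_pos (ht t h) (ht t h)
    linarith
  · rw [curvOf, hβT' t h, hβn t h]; rfl
  · rw [torsOf, hβN' t h, hβB t h, hβn t h]
    exact div_self (ht t h).ne'
end
end

section
/- Let α : I → ℝ³ be a smooth time-like curve parameterized by arc length with Frenet frame T_α = α′, N_α = α′′/κ_α where κ_α = ‖α′′‖ > 0, B_α = T_α ×_L N_α, and torsion τ_α = ⟨N_α′, B_α⟩. Fix t₀ ∈ I and define β(t) = ∫_{t₀}^{t} T_α(u)·‖T_α′(u)‖ du. Then β is a regular time-like curve with ‖β′‖ = κ_α, and its Frenet apparatus (defined with speed v = ‖β′‖, T_β = β′/v, κ_β = ‖T_β′‖/v, N_β = T_β′/‖T_β′‖, B_β = T_β ×_L N_β, τ_β = ⟨N_β′, B_β⟩/v) satisfies κ_β = 1, τ_β = τ_α/κ_α, T_β = T_α, N_β = N_α, and B_β = B_α. -/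
/- Minkowski 3-space: ℝ³ with the bilinear form ⟨u,v⟩ = -u₁v₁ + u₂v₂ + u₃v₃. -/

noncomputable section

/-- The Minkowski form of a scalar multiple. -/
theorem mink_smul_smul (c : ℝ) (u : Fin 3 → ℝ) : mink (c • u) (c • u) = c ^ 2 * mink u u := by
  simp only [mink, Pi.smul_apply, smul_eq_mul]
  ring

/-- The Minkowski norm is continuous. -/
theorem continuous_mnorm : Continuous mnorm := by
  unfold mnorm mink
  fun_prop

/-- The derivative of the integral curve. -/
theorem deriv_beta (a b t₀ : ℝ) (α : ℝ → Fin 3 → ℝ) (ht₀ : t₀ ∈ Set.Ioo a b)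
    (hsmooth : ContDiffOn ℝ (⊤ : ℕ∞) α (Set.Ioo a b)) (t : ℝ) (ht : t ∈ Set.Ioo a b) :
    deriv (fun s : ℝ => ∫ u in t₀..s, mnorm (deriv (deriv α) u) • deriv α u) t
      = kArc α t • deriv α t := by
  have h1 : ContDiffOn ℝ 1 (deriv α) (Set.Ioo a b) :=
    hsmooth.deriv_of_isOpen isOpen_Ioo (by norm_cast)
  have h2 : ContinuousOn (deriv (deriv α)) (Set.Ioo a b) :=
    h1.continuousOn_deriv_of_isOpen isOpen_Ioo le_rfl
  have hc : ContinuousOn (fun u => mnorm (deriv (deriv α) u) • deriv α u) (Set.Ioo a b) :=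
    (continuous_mnorm.comp_continuousOn h2).smul h1.continuousOn
  have hsub : Set.uIcc t₀ t ⊆ Set.Ioo a b := Set.ordConnected_Ioo.uIcc_subset ht₀ ht
  exact (intervalIntegral.integral_hasDerivAt_right (hc.mono hsub).intervalIntegrable
    (hc.stronglyMeasurableAtFilter isOpen_Ioo t ht)
    (hc.continuousAt (isOpen_Ioo.mem_nhds ht))).deriv

/-- from a unit-speed time-like curve α with κ_α > 0, the curve
β(t) = ∫_{t₀}^t T_α(u)·‖T_α'(u)‖ du is a regular time-like curve with speed κ_α,
curvature 1, torsion τ_α/κ_α, and the same Frenet frame as α. -/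
theorem constant_curvature_from_constant_torsion (a b t₀ : ℝ) (α : ℝ → Fin 3 → ℝ)
    (hab : a < b) (ht₀ : t₀ ∈ Set.Ioo a b)
    (hsmooth : ContDiffOn ℝ (⊤ : ℕ∞) α (Set.Ioo a b))
    (hunit : ∀ t ∈ Set.Ioo a b, mink (deriv α t) (deriv α t) = -1)
    (hk : ∀ t ∈ Set.Ioo a b, 0 < kArc α t) :
    ∀ t ∈ Set.Ioo a b,
      mink (deriv (fun s : ℝ => ∫ u in t₀..s, mnorm (deriv (deriv α) u) • deriv α u) t)
        (deriv (fun s : ℝ => ∫ u in t₀..s, mnorm (deriv (deriv α) u) • deriv α u) t) < 0 ∧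
      mnorm (deriv (fun s : ℝ => ∫ u in t₀..s, mnorm (deriv (deriv α) u) • deriv α u) t)
        = kArc α t ∧
      curvOf (fun s : ℝ => ∫ u in t₀..s, mnorm (deriv (deriv α) u) • deriv α u) t = 1 ∧
      torsOf (fun s : ℝ => ∫ u in t₀..s, mnorm (deriv (deriv α) u) • deriv α u) t
        = tArc α t / kArc α t ∧
      Tof (fun s : ℝ => ∫ u in t₀..s, mnorm (deriv (deriv α) u) • deriv α u) t
        = deriv α t ∧
      Nof (fun s : ℝ => ∫ u in t₀..s, mnorm (deriv (deriv α) u) • deriv α u) t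
        = NArc α t ∧
      Bof (fun s : ℝ => ∫ u in t₀..s, mnorm (deriv (deriv α) u) • deriv α u) t
        = BArc α t := by
  have hd := deriv_beta a b t₀ α ht₀ hsmooth
  generalize (fun s : ℝ => ∫ u in t₀..s, mnorm (deriv (deriv α) u) • deriv α u) = β at hd ⊢
  have hm : ∀ t ∈ Set.Ioo a b, mink (deriv β t) (deriv β t) = - kArc α t ^ 2 := by
    intro t ht
    rw [hd t ht, mink_smul_smul, hunit t ht]
    ring
  have hn : ∀ t ∈ Set.Ioo a b, mnorm (deriv β t) = kArc α t := by
    intro t ht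
    rw [mnorm, hm t ht, abs_neg, abs_of_nonneg (sq_nonneg _), Real.sqrt_sq (hk t ht).le]
  have hT : Set.EqOn (Tof β) (deriv α) (Set.Ioo a b) := by
    intro t ht
    rw [Tof, hn t ht, hd t ht, inv_smul_smul₀ (hk t ht).ne']
  have hT' : Set.EqOn (deriv (Tof β)) (deriv (deriv α)) (Set.Ioo a b) := by
    intro t ht
    exact (hT.eventuallyEq_of_mem (isOpen_Ioo.mem_nhds ht)).deriv_eq
  have hN : Set.EqOn (Nof β) (NArc α) (Set.Ioo a b) := by
    intro t ht
    rw [Nof, hT' ht, NArc, kArc]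
  have hB : Set.EqOn (Bof β) (BArc α) (Set.Ioo a b) := by
    intro t ht
    rw [Bof, hT ht, hN ht, BArc]
  intro t ht
  have hN' : deriv (Nof β) t = deriv (NArc α) t :=
    (hN.eventuallyEq_of_mem (isOpen_Ioo.mem_nhds ht)).deriv_eq
  refine ⟨?_, hn t ht, ?_, ?_, hT ht, hN ht, hB ht⟩
  · rw [hm t ht]
    exact neg_lt_zero.mpr (pow_pos (hk t ht) 2)
  · rw [curvOf, hn t ht, hT' ht]
    exact div_self (hk t ht).ne'
  · rw [torsOf, hn t ht, hN', hB ht, tArc]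
end
end

section
/- For every real m > 1, setting n = m/√(m²−1), the time-like anti-Salkowski curve β_m satisfies ⟨β_m′(t), β_m′(t)⟩ = −cosh²(nt)/(m²−1) for all real t; in particular β_m′(t) is time-like for every t, with Minkowski norm ‖β_m′(t)‖ = cosh(nt)/√(m²−1). -/
/- Minkowski 3-space: ℝ³ with the bilinear form ⟨u,v⟩ = -u₁v₁ + u₂v₂ + u₃v₃. -/

noncomputable section

/-- The time-like anti-Salkowski curve β_m in Minkowski 3-space. -/
def antiSalkowski (m : ℝ) (t : ℝ) : Fin 3 → ℝ :=
  (nval m / (4 * m)) •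
    ![((nval m - 1) / (2 * nval m + 1)) * Real.sinh ((1 + 2 * nval m) * t)
        - ((nval m + 1) / (2 * nval m - 1)) * Real.sinh ((1 - 2 * nval m) * t)
        + 2 * nval m * Real.sinh t,
      ((nval m - 1) / (2 * nval m + 1)) * Real.cosh ((1 + 2 * nval m) * t)
        - ((nval m + 1) / (2 * nval m - 1)) * Real.cosh ((1 - 2 * nval m) * t)
        + 2 * nval m * Real.cosh t,
      -(1 / m) * (Real.sinh (2 * nval m * t) + 2 * nval m * t)]

/-- ⟨β_m'(t), β_m'(t)⟩ = -cosh²(nt)/(m²-1) for all t; in particular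
β_m'(t) is time-like for every t, with ‖β_m'(t)‖ = cosh(nt)/√(m²-1). -/
theorem antiSalkowski_deriv_mink (m n : ℝ) (hm : 1 < m)
    (hn : n = m / Real.sqrt (m ^ 2 - 1)) :
    ∀ t : ℝ,
      mink (deriv (antiSalkowski m) t) (deriv (antiSalkowski m) t)
        = -Real.cosh (n * t) ^ 2 / (m ^ 2 - 1) ∧
      mink (deriv (antiSalkowski m) t) (deriv (antiSalkowski m) t) < 0 ∧
      mnorm (deriv (antiSalkowski m) t) = Real.cosh (n * t) / Real.sqrt (m ^ 2 - 1) := by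
  intro t
  have hp : 0 < m ^ 2 - 1 := by nlinarith
  have hr : 0 < Real.sqrt (m ^ 2 - 1) := Real.sqrt_pos.mpr hp
  have hr2 : Real.sqrt (m ^ 2 - 1) ^ 2 = m ^ 2 - 1 := Real.sq_sqrt hp.le
  have hm0 : m ≠ 0 := by linarith
  have hnv : nval m = n := by rw [hn]; rfl
  have hn2 : n ^ 2 = m ^ 2 / (m ^ 2 - 1) := by rw [hn, div_pow, hr2]
  have hnpos : 0 < n := by rw [hn]; positivity
  have hn1 : 1 < n := by
    have h : 1 < n ^ 2 := by rw [hn2, lt_div_iff₀ hp]; linarith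
    nlinarith
  have hd1 : 2 * n + 1 ≠ 0 := by linarith
  have hd2 : 2 * n - 1 ≠ 0 := by linarith
  have hlin : ∀ a : ℝ, HasDerivAt (fun t : ℝ => a * t) a t := fun a => by
    simpa using (hasDerivAt_id t).const_mul a
  have hD : HasDerivAt (antiSalkowski m)
      ((n / (4 * m)) •
        ![((n - 1) / (2 * n + 1)) * (Real.cosh ((1 + 2 * n) * t) * (1 + 2 * n))
            - ((n + 1) / (2 * n - 1)) * (Real.cosh ((1 - 2 * n) * t) * (1 - 2 * n))
            + 2 * n * Real.cosh t,
          ((n - 1) / (2 * n + 1)) * (Real.sinh ((1 + 2 * n) * t) * (1 + 2 * n))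
            - ((n + 1) / (2 * n - 1)) * (Real.sinh ((1 - 2 * n) * t) * (1 - 2 * n))
            + 2 * n * Real.sinh t,
          -(1 / m) * (Real.cosh (2 * n * t) * (2 * n) + 2 * n)]) t := by
    unfold antiSalkowski
    rw [hnv]
    apply HasDerivAt.fun_const_smul
    rw [hasDerivAt_pi]
    intro i
    fin_cases i
    · exact (((hlin (1 + 2 * n)).sinh.const_mul _).sub
        ((hlin (1 - 2 * n)).sinh.const_mul _)).add ((Real.hasDerivAt_sinh t).const_mul _)
    · exact (((hlin (1 + 2 * n)).cosh.const_mul _).sub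
        ((hlin (1 - 2 * n)).cosh.const_mul _)).add ((Real.hasDerivAt_cosh t).const_mul _)
    · exact ((hlin (2 * n)).sinh.add (hlin (2 * n))).const_mul _
  have key : mink (deriv (antiSalkowski m) t) (deriv (antiSalkowski m) t)
        = -Real.cosh (n * t) ^ 2 / (m ^ 2 - 1) := by
    rw [hD.deriv]
    have e1 : (1 + 2 * n) * t = t + 2 * n * t := by ring
    have e2 : (1 - 2 * n) * t = t - 2 * n * t := by ring
    have e3 : ∀ x : ℝ, (n - 1) / (2 * n + 1) * (x * (1 + 2 * n)) = (n - 1) * x := by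
      intro x; field_simp; ring
    have e4 : ∀ x : ℝ, (n + 1) / (2 * n - 1) * (x * (1 - 2 * n)) = -((n + 1) * x) := by
      intro x; rw [div_mul_eq_mul_div, div_eq_iff hd2]; ring
    have hC : Real.cosh (2 * n * t) = 2 * Real.cosh (n * t) ^ 2 - 1 := by
      rw [mul_assoc, Real.cosh_two_mul, Real.sinh_sq]; ring
    have hS := Real.sinh_sq (2 * n * t)
    have hs := Real.sinh_sq t
    have hk : n ^ 2 / m ^ 2 = 1 / (m ^ 2 - 1) := by rw [hn2]; field_simp
    have hk2 : n ^ 2 / m ^ 2 = n ^ 2 - 1 := by rw [hk, hn2]; field_simp; ring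
    simp only [mink, Pi.smul_apply, smul_eq_mul, Matrix.cons_val]
    rw [e3, e4, e3, e4, e1, e2, Real.cosh_add, Real.cosh_sub, Real.sinh_add, Real.sinh_sub]
    have hK : Real.cosh (n * t) ^ 2 = (Real.cosh (2 * n * t) + 1) / 2 := by rw [hC]; ring
    rw [hK]
    generalize Real.cosh (2 * n * t) = C at *
    generalize Real.sinh (2 * n * t) = S at *
    generalize Real.cosh t = c at *
    generalize Real.sinh t = s at *
    have hR : -((C + 1) / 2) / (m ^ 2 - 1) = -((C + 1) / 2) * (n ^ 2 / m ^ 2) := by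
      rw [hk]; ring
    rw [hR]
    have hL : (n ^ 2 / m ^ 2) / 4 * (-(n * (C + 1)) ^ 2 * (c ^ 2 - s ^ 2) + S ^ 2 * (c ^ 2 - s ^ 2)
        + (n ^ 2 / m ^ 2) * (C + 1) ^ 2) = -((C + 1) / 2) * (n ^ 2 / m ^ 2) := by
      have : c ^ 2 - s ^ 2 = 1 := by rw [hs]; ring
      rw [this, hS]
      generalize n ^ 2 / m ^ 2 = q at *
      rw [hk2]; ring
    rw [← hL]
    field_simp
    ring
  have hc : 0 < Real.cosh (n * t) := Real.cosh_pos _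
  refine ⟨key, ?_, ?_⟩
  · rw [key, neg_div]
    exact neg_lt_zero.mpr (by positivity)
  · unfold mnorm
    rw [key, neg_div, abs_neg, abs_of_nonneg (by positivity), Real.sqrt_div (by positivity),
      Real.sqrt_sq hc.le]
end
end

section
/- For every real m > 1, setting n = m/√(m²−1), the curvature of the time-like anti-Salkowski curve β_m, computed as κ(t) = ‖T′(t)‖/‖β_m′(t)‖ with T(t) = β_m′(t)/‖β_m′(t)‖, equals tanh(nt) for all t > 0; in particular β_m has non-constant curvature. -/
/- Minkowski 3-space: ℝ³ with the bilinear form ⟨u,v⟩ = -u₁v₁ + u₂v₂ + u₃v₃. -/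

noncomputable section

/-- The basic relations between `m` and `n`. -/
lemma nval_facts (m : ℝ) (hm : 1 < m) :
    1 < nval m ∧ (nval m) ^ 2 * (m ^ 2 - 1) = m ^ 2 := by
  have h1 : 0 < m ^ 2 - 1 := by nlinarith
  have hs : 0 < Real.sqrt (m ^ 2 - 1) := Real.sqrt_pos.2 h1
  have hsq : Real.sqrt (m ^ 2 - 1) ^ 2 = m ^ 2 - 1 := Real.sq_sqrt h1.le
  refine ⟨?_, ?_⟩
  · unfold nval
    rw [lt_div_iff₀ hs, one_mul]
    nlinarith
  · unfold nval
    rw [div_pow, hsq]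
    field_simp

/-- The (closed form of the) unit tangent. -/
def tanVec (m n t : ℝ) : Fin 3 → ℝ :=
  ![n * Real.cosh t * Real.cosh (n * t) - Real.sinh t * Real.sinh (n * t),
    n * Real.sinh t * Real.cosh (n * t) - Real.cosh t * Real.sinh (n * t),
    -(n / m) * Real.cosh (n * t)]

lemma hasDerivAt_sinh_lin (a t : ℝ) :
    HasDerivAt (fun t => Real.sinh (a * t)) (a * Real.cosh (a * t)) t := by
  have h := ((hasDerivAt_id t).const_mul a).sinh
  simpa [mul_comm] using h

lemma hasDerivAt_cosh_lin (a t : ℝ) :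
    HasDerivAt (fun t => Real.cosh (a * t)) (a * Real.sinh (a * t)) t := by
  have h := ((hasDerivAt_id t).const_mul a).cosh
  simpa [mul_comm] using h

lemma cosh_add_two (n t : ℝ) : Real.cosh ((1 + 2 * n) * t) =
    Real.cosh t * (2 * Real.cosh (n * t) ^ 2 - 1)
      + Real.sinh t * (2 * Real.sinh (n * t) * Real.cosh (n * t)) := by
  rw [show (1 + 2 * n) * t = t + 2 * (n * t) by ring, Real.cosh_add, Real.cosh_two_mul,
    Real.sinh_two_mul, Real.sinh_sq]
  ring

lemma cosh_sub_two (n t : ℝ) : Real.cosh ((1 - 2 * n) * t) =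
    Real.cosh t * (2 * Real.cosh (n * t) ^ 2 - 1)
      - Real.sinh t * (2 * Real.sinh (n * t) * Real.cosh (n * t)) := by
  rw [show (1 - 2 * n) * t = t - 2 * (n * t) by ring, Real.cosh_sub, Real.cosh_two_mul,
    Real.sinh_two_mul, Real.sinh_sq]
  ring

lemma sinh_add_two (n t : ℝ) : Real.sinh ((1 + 2 * n) * t) =
    Real.sinh t * (2 * Real.cosh (n * t) ^ 2 - 1)
      + Real.cosh t * (2 * Real.sinh (n * t) * Real.cosh (n * t)) := by
  rw [show (1 + 2 * n) * t = t + 2 * (n * t) by ring, Real.sinh_add, Real.cosh_two_mul,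
    Real.sinh_two_mul, Real.sinh_sq]
  ring

lemma sinh_sub_two (n t : ℝ) : Real.sinh ((1 - 2 * n) * t) =
    Real.sinh t * (2 * Real.cosh (n * t) ^ 2 - 1)
      - Real.cosh t * (2 * Real.sinh (n * t) * Real.cosh (n * t)) := by
  rw [show (1 - 2 * n) * t = t - 2 * (n * t) by ring, Real.sinh_sub, Real.cosh_two_mul,
    Real.sinh_two_mul, Real.sinh_sq]
  ring

lemma hasDerivAt_antiSalkowski (m : ℝ) (hm : 1 < m) (t : ℝ) :
    HasDerivAt (antiSalkowski m)
      ((nval m / m * Real.cosh (nval m * t)) • tanVec m (nval m) t) t := by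
  obtain ⟨hn, -⟩ := nval_facts m hm
  unfold antiSalkowski
  generalize nval m = n at *
  have hm0 : m ≠ 0 := by positivity
  have h1 : 2 * n + 1 ≠ 0 := by linarith
  have h2 : 2 * n - 1 ≠ 0 := by linarith
  have ha : ∀ X : ℝ, (n - 1) / (2 * n + 1) * ((1 + 2 * n) * X) = (n - 1) * X := by
    intro X
    field_simp
    ring
  have hb : ∀ X : ℝ, (n + 1) / (2 * n - 1) * ((1 - 2 * n) * X) = -(n + 1) * X := by
    intro X
    rw [div_mul_eq_mul_div, div_eq_iff h2]
    ring
  rw [hasDerivAt_pi]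
  intro i
  fin_cases i
  · have h := (((((hasDerivAt_sinh_lin (1 + 2 * n) t).const_mul ((n - 1) / (2 * n + 1))).sub
      ((hasDerivAt_sinh_lin (1 - 2 * n) t).const_mul ((n + 1) / (2 * n - 1)))).add
      ((Real.hasDerivAt_sinh t).const_mul (2 * n)))).const_mul (n / (4 * m))
    refine h.congr_deriv ?_
    rw [ha, hb, cosh_add_two, cosh_sub_two]
    simp [tanVec]
    field_simp
    ring
  · have h := (((((hasDerivAt_cosh_lin (1 + 2 * n) t).const_mul ((n - 1) / (2 * n + 1))).sub
      ((hasDerivAt_cosh_lin (1 - 2 * n) t).const_mul ((n + 1) / (2 * n - 1)))).add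
      ((Real.hasDerivAt_cosh t).const_mul (2 * n)))).const_mul (n / (4 * m))
    refine h.congr_deriv ?_
    rw [ha, hb, sinh_add_two, sinh_sub_two]
    simp [tanVec]
    field_simp
    ring
  · have h := (((hasDerivAt_sinh_lin (2 * n) t).add
      ((hasDerivAt_id t).const_mul (2 * n))).const_mul (-(1 / m))).const_mul (n / (4 * m))
    refine h.congr_deriv ?_
    rw [show 2 * n * t = 2 * (n * t) by ring, Real.cosh_two_mul, Real.sinh_sq]
    simp [tanVec]
    field_simp
    ring

lemma hasDerivAt_tanVec (m n t : ℝ) :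
    HasDerivAt (tanVec m n) (Real.sinh (n * t) •
      ![(n ^ 2 - 1) * Real.cosh t, (n ^ 2 - 1) * Real.sinh t, -(n ^ 2 / m)]) t := by
  unfold tanVec
  rw [hasDerivAt_pi]
  intro i
  fin_cases i
  · have h := (((Real.hasDerivAt_cosh t).const_mul n).mul (hasDerivAt_cosh_lin n t)).sub
      ((Real.hasDerivAt_sinh t).mul (hasDerivAt_sinh_lin n t))
    refine h.congr_deriv ?_
    simp
    ring
  · have h := (((Real.hasDerivAt_sinh t).const_mul n).mul (hasDerivAt_cosh_lin n t)).sub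
      ((Real.hasDerivAt_cosh t).mul (hasDerivAt_sinh_lin n t))
    refine h.congr_deriv ?_
    simp
    ring
  · have h := (hasDerivAt_cosh_lin n t).const_mul (-(n / m))
    refine h.congr_deriv ?_
    simp
    ring

lemma mnorm_smul (a : ℝ) (u : Fin 3 → ℝ) : mnorm (a • u) = |a| * mnorm u := by
  unfold mnorm
  have h : mink (a • u) (a • u) = a ^ 2 * mink u u := by
    simp [mink]
    ring
  rw [h, abs_mul, Real.sqrt_mul (abs_nonneg _), abs_of_nonneg (sq_nonneg a), Real.sqrt_sq_eq_abs]

lemma mnorm_tanVec (m : ℝ) (hm : 1 < m) (t : ℝ) : mnorm (tanVec m (nval m) t) = 1 := by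
  obtain ⟨hn, hr⟩ := nval_facts m hm
  generalize nval m = n at *
  have hm0 : m ≠ 0 := by positivity
  have hq : n ^ 2 / m ^ 2 = n ^ 2 - 1 := by
    field_simp
    linarith
  have h : mink (tanVec m n t) (tanVec m n t) = -1 := by
    have e : mink (tanVec m n t) (tanVec m n t) =
      (-n ^ 2 * Real.cosh (n * t) ^ 2 + Real.sinh (n * t) ^ 2)
        * (Real.cosh t ^ 2 - Real.sinh t ^ 2) + n ^ 2 / m ^ 2 * Real.cosh (n * t) ^ 2 := by
      simp only [mink, tanVec, Matrix.cons_val]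
      ring
    rw [e, hq, Real.cosh_sq t, Real.cosh_sq (n * t)]
    ring
  simp [mnorm, h]

lemma mnorm_norVec (m : ℝ) (hm : 1 < m) (t : ℝ) :
    mnorm ![((nval m) ^ 2 - 1) * Real.cosh t, ((nval m) ^ 2 - 1) * Real.sinh t,
      -((nval m) ^ 2 / m)] = nval m / m := by
  obtain ⟨hn, hr⟩ := nval_facts m hm
  generalize nval m = n at *
  have hm0 : m ≠ 0 := by positivity
  have hq : n ^ 2 / m ^ 2 = n ^ 2 - 1 := by
    field_simp
    linarith
  have h : mink ![(n ^ 2 - 1) * Real.cosh t, (n ^ 2 - 1) * Real.sinh t, -(n ^ 2 / m)]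
      ![(n ^ 2 - 1) * Real.cosh t, (n ^ 2 - 1) * Real.sinh t, -(n ^ 2 / m)] = (n / m) ^ 2 := by
    have e : mink ![(n ^ 2 - 1) * Real.cosh t, (n ^ 2 - 1) * Real.sinh t, -(n ^ 2 / m)]
      ![(n ^ 2 - 1) * Real.cosh t, (n ^ 2 - 1) * Real.sinh t, -(n ^ 2 / m)] =
      -(n ^ 2 - 1) ^ 2 * (Real.cosh t ^ 2 - Real.sinh t ^ 2) + n ^ 2 * (n ^ 2 / m ^ 2) := by
      simp only [mink, Matrix.cons_val]
      ring
    rw [e, div_pow, hq, Real.cosh_sq t]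
    ring
  have hp : 0 ≤ n / m := by positivity
  rw [mnorm, h, abs_of_nonneg (sq_nonneg _), Real.sqrt_sq hp]

lemma curvOf_antiSalkowski (m : ℝ) (hm : 1 < m) (t : ℝ) (ht : 0 < t) :
    curvOf (antiSalkowski m) t = Real.tanh (nval m * t) := by
  obtain ⟨hn, -⟩ := nval_facts m hm
  have hs : 0 < nval m / m := div_pos (by linarith) (by linarith)
  have hpos : ∀ s, 0 < nval m / m * Real.cosh (nval m * s) :=
    fun s => mul_pos hs (Real.cosh_pos _)
  have hd : ∀ s, mnorm (deriv (antiSalkowski m) s) = nval m / m * Real.cosh (nval m * s) := by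
    intro s
    rw [(hasDerivAt_antiSalkowski m hm s).deriv, mnorm_smul, mnorm_tanVec m hm,
      abs_of_pos (hpos s), mul_one]
  have hT : Tof (antiSalkowski m) = tanVec m (nval m) := by
    funext s
    rw [Tof, hd, (hasDerivAt_antiSalkowski m hm s).deriv, smul_smul,
      inv_mul_cancel₀ (hpos s).ne', one_smul]
  have hsh : 0 < Real.sinh (nval m * t) :=
    Real.sinh_pos_iff.2 (mul_pos (by linarith) ht)
  rw [curvOf, hd, hT, (hasDerivAt_tanVec m (nval m) t).deriv, mnorm_smul, mnorm_norVec m hm,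
    abs_of_pos hsh, Real.tanh_eq_sinh_div_cosh, mul_comm (Real.sinh _),
    mul_div_mul_left _ _ hs.ne']

/-- the curvature of the anti-Salkowski curve β_m equals tanh(nt) for
t > 0; in particular β_m has non-constant curvature. -/
theorem antiSalkowski_curvature (m n : ℝ) (hm : 1 < m)
    (hn : n = m / Real.sqrt (m ^ 2 - 1)) :
    (∀ t : ℝ, 0 < t → curvOf (antiSalkowski m) t = Real.tanh (n * t)) ∧
    ¬ (∃ c : ℝ, ∀ t : ℝ, 0 < t → curvOf (antiSalkowski m) t = c) := by
  have hnv : n = nval m := hn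
  subst hnv
  obtain ⟨hn1, -⟩ := nval_facts m hm
  refine ⟨fun t ht => curvOf_antiSalkowski m hm t ht, ?_⟩
  rintro ⟨c, hc⟩
  have h1 := hc 1 one_pos
  have h2 := hc 2 two_pos
  rw [curvOf_antiSalkowski m hm _ one_pos] at h1
  rw [curvOf_antiSalkowski m hm _ two_pos] at h2
  have h3 := Real.tanh_injective (h1.trans h2.symm)
  linarith
end
end
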